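/- Let R be a commutative Noetherian ring, a an ideal of R, M a finitely generated R-module, and n a non-negative integer. Then for every integer i with i < f_a^n(M), the local cohomology module H^i_a(M) is in dimension < n. -/

import Mathlib

open CategoryTheory

noncomputable section

/-- An `R`-module `M` is *in dimension `< n`* if there exists a finitely generated
submodule `N ⊆ M` such that `dim Supp (M/N) < n`. -/
def InDimLT (R : Type) [CommRing R] (M : Type) [AddCommGroup M] [Module R M] (n : ℕ) : Prop :=
  ∃ N : Submodule R M, N.FG ∧ Order.krullDim (Module.support R (M ⧸ N)) < (n : WithBot ℕ∞)

/-- The `i`-th local cohomology module of `M` with support in the ideal `a`. -/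
def locCoh (R : Type) [CommRing R] (a : Ideal R) (i : ℕ)
    (M : Type) [AddCommGroup M] [Module R M] : ModuleCat R :=
  (localCohomology a i).obj (ModuleCat.of R M)

/-- The finiteness dimension `f_a(M)`:  the least `i` such that `H^i_a(M)` is not
finitely generated (`∞` if there is no such `i`). -/
def finDim (R : Type) [CommRing R] (a : Ideal R)
    (M : Type) [AddCommGroup M] [Module R M] : ℕ∞ :=
  sInf (Nat.cast '' {i : ℕ | ¬ Module.Finite R ↥(locCoh R a i M)})

/-- The `n`-th finiteness dimension `f_a^n(M)`. -/
def finDimN (R : Type) [CommRing R] (a : Ideal R) (n : ℕ)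
    (M : Type) [AddCommGroup M] [Module R M] : ℕ∞ :=
  sInf {d : ℕ∞ | ∃ p : PrimeSpectrum R,
    p ∈ Module.support R (M ⧸ (a • ⊤ : Submodule R M)) ∧
    (n : WithBot ℕ∞) ≤ ringKrullDim (R ⧸ p.asIdeal) ∧
    d = finDim (Localization.AtPrime p.asIdeal)
      (a.map (algebraMap R (Localization.AtPrime p.asIdeal)))
      (LocalizedModule p.asIdeal.primeCompl M)}

/-- `h_a^n(M)`: the least `i` such that `H^i_a(M)` is not in dimension `< n`. -/
def hDimN (R : Type) [CommRing R] (a : Ideal R) (n : ℕ)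
    (M : Type) [AddCommGroup M] [Module R M] : ℕ∞ :=
  sInf (Nat.cast '' {i : ℕ | ¬ InDimLT R ↥(locCoh R a i M) n})

section LocalCohomology

variable {R : Type} [CommRing R]

lemma paste_squares {C : Type*} [Category* C] {A B D A' B' D' : C} {u : A ⟶ A'} {v : B ⟶ B'}
    {w : D ⟶ D'} {x : A ⟶ B} {x' : A' ⟶ B'} {y : B ⟶ D} {y' : B' ⟶ D'} (h : u ≫ x' = x ≫ v)
    (h' : v ≫ y' = y ≫ w) : u ≫ x' ≫ y' = (x ≫ y) ≫ w := by
  rw [← Category.assoc, h, Category.assoc, h', Category.assoc]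

lemma unop_inv_square {C : Type*} [Category* C] {A B A' B' : C} {e : Opposite.op A ≅ Opposite.op B}
    {e' : Opposite.op A' ≅ Opposite.op B'} {u : Opposite.op A' ⟶ Opposite.op A} {v : B ⟶ B'}
    (h : u ≫ e.hom = e'.hom ≫ v.op) : u.unop ≫ e'.inv.unop = e.inv.unop ≫ v := by
  apply Quiver.Hom.op_inj
  simp only [op_comp, Quiver.Hom.op_unop]
  rw [Iso.inv_comp_eq, ← Category.assoc, Iso.eq_comp_inv, h]

/-- The map `Hom(Q, M) ⟶ Hom(P, M)` of cochain complexes given by precomposition with `φ`. -/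
def precompMap {P Q : ChainComplex (ModuleCat.{0} R) ℕ} (φ : P ⟶ Q) (M : ModuleCat.{0} R) :
    Q.linearYonedaObj R M ⟶ P.linearYonedaObj R M where
  f i := ModuleCat.ofHom (Linear.leftComp R M (φ.f i))
  comm' i j h := by
    ext (x : Q.X i ⟶ M)
    exact (φ.comm_assoc j i x).symm

lemma isoExt_hom_naturality {X Y : ModuleCat.{0} R} (f : X ⟶ Y) (P : ProjectiveResolution X)
    (Q : ProjectiveResolution Y) (φ : P.complex ⟶ Q.complex)
    (comm : φ.f 0 ≫ Q.π.f 0 = P.π.f 0 ≫ f) (n : ℕ) (M : ModuleCat.{0} R) :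
    ((Ext R (ModuleCat.{0} R) n).map f.op).app M ≫ (P.isoExt (R := R) n M).hom =
      (Q.isoExt (R := R) n M).hom ≫ HomologicalComplex.homologyMap (precompMap φ M) n := by
  exact paste_squares (congrArg Quiver.Hom.unop
      (ProjectiveResolution.isoLeftDerivedObj_inv_naturality f P Q φ comm
        ((linearYoneda R (ModuleCat.{0} R)).obj M).rightOp n))
    (unop_inv_square (HomologicalComplex.homologyOp_hom_naturality (precompMap φ M) n))

/-- The cocycles of degree `n` in `Hom(P, M)`. -/
abbrev cocyc {X : ModuleCat.{0} R} (P : ProjectiveResolution X) (M : ModuleCat.{0} R) (n : ℕ) :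
    Submodule R (P.complex.X n ⟶ M) :=
  LinearMap.ker (Linear.leftComp R M (P.complex.d (n+1) n))

lemma mem_cocyc {X : ModuleCat.{0} R} (P : ProjectiveResolution X) (M : ModuleCat.{0} R) (n : ℕ)
    (f : P.complex.X n ⟶ M) : f ∈ cocyc P M n ↔ P.complex.d (n+1) n ≫ f = 0 := Iff.rfl

/-- The map from cocycles to homology. -/
def toHomology (K : CochainComplex (ModuleCat.{0} R) ℕ) (n : ℕ) :
    LinearMap.ker (K.d n (n+1)).hom →ₗ[R] K.homology n :=
  (K.homologyπ n).hom ∘ₗ (K.liftCycles (A := ModuleCat.of R (LinearMap.ker (K.d n (n+1)).hom))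
      (ModuleCat.ofHom (Submodule.subtype _)) (n+1) (by simp)
    (by ext x; exact x.2)).hom

lemma toHomology_surjective (K : CochainComplex (ModuleCat.{0} R) ℕ) (n : ℕ) :
    Function.Surjective (toHomology K n) := by
  intro y
  obtain ⟨z, rfl⟩ := (ModuleCat.epi_iff_surjective (K.homologyπ n)).1 inferInstance y
  refine ⟨⟨(K.iCycles n).hom z, ?_⟩, ?_⟩
  · have := congrArg (fun f => f.hom z) (K.iCycles_d n (n+1))
    exact this
  · change (K.homologyπ n).hom _ = _
    congr 1
    apply (ModuleCat.mono_iff_injective (K.iCycles n)).1 inferInstance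
    change ((_ : ModuleCat.of R _ ⟶ _) ≫ (K.iCycles n)).hom _ = _
    rw [HomologicalComplex.liftCycles_i]
    rfl

lemma toHomology_eq_zero (K : CochainComplex (ModuleCat.{0} R) ℕ) (n j : ℕ)
    (hj : (ComplexShape.up ℕ).prev n = j) (z) :
    toHomology K n z = 0 ↔ ∃ y, (K.d j n).hom y = z.1 := by
  have hE : (ShortComplex.mk _ _ (K.toCycles_comp_homologyπ j n)).Exact :=
    ShortComplex.exact_of_g_is_cokernel _ (K.homologyIsCokernel j n hj)
  rw [ShortComplex.moduleCat_exact_iff] at hE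
  have hi := (ModuleCat.mono_iff_injective (K.iCycles n)).1 inferInstance
  set c : K.cycles n := (K.liftCycles (A := ModuleCat.of R (LinearMap.ker (K.d n (n+1)).hom))
      (ModuleCat.ofHom (Submodule.subtype _)) (n+1) (by simp)
    (by ext x; exact x.2)).hom z with hc
  have hcz : (K.iCycles n).hom c = z.1 := by
    change ((_ : ModuleCat.of R _ ⟶ _) ≫ (K.iCycles n)).hom _ = _
    rw [HomologicalComplex.liftCycles_i]
    rfl
  have hti : ∀ y, (K.iCycles n).hom ((K.toCycles j n).hom y) = (K.d j n).hom y := by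
    intro y
    rw [← K.toCycles_i j n]; rfl
  constructor
  · intro h
    obtain ⟨y, hy⟩ := hE c h
    refine ⟨y, ?_⟩
    rw [← hcz, ← hti]
    exact congrArg _ hy
  · rintro ⟨y, hy⟩
    have : c = (K.toCycles j n).hom y := hi (by rw [hti, hy]; exact hcz)
    change (K.homologyπ n).hom c = 0
    rw [this]
    exact congrArg (fun f => f.hom y) (K.toCycles_comp_homologyπ j n)

lemma toHomology_naturality {K L : CochainComplex (ModuleCat.{0} R) ℕ} (φ : K ⟶ L) (n : ℕ)
    (z : LinearMap.ker (K.d n (n+1)).hom) (z' : LinearMap.ker (L.d n (n+1)).hom)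
    (h : (φ.f n).hom z.1 = z'.1) :
    (HomologicalComplex.homologyMap φ n).hom (toHomology K n z) = toHomology L n z' := by
  have hi := (ModuleCat.mono_iff_injective (L.iCycles n)).1 inferInstance
  change ((K.homologyπ n) ≫ (HomologicalComplex.homologyMap φ n)).hom _ = (L.homologyπ n).hom _
  rw [HomologicalComplex.homologyπ_naturality]
  change (L.homologyπ n).hom _ = (L.homologyπ n).hom _
  congr 1
  apply hi
  change ((_ : ModuleCat.of R _ ⟶ _) ≫ HomologicalComplex.cyclesMap φ n ≫ (L.iCycles n)).hom z =
      ((_ : ModuleCat.of R _ ⟶ _) ≫ (L.iCycles n)).hom z'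
  rw [HomologicalComplex.cyclesMap_i, HomologicalComplex.liftCycles_i, HomologicalComplex.liftCycles_i_assoc]
  exact h

open Abelian in
lemma extMk_smul {X M : ModuleCat.{0} R} (P : ProjectiveResolution X) {n : ℕ} (r : R)
    (f : P.complex.X n ⟶ M) (hf : P.complex.d (n + 1) n ≫ f = 0) :
    P.extMk (r • f) (n+1) rfl (by rw [Linear.comp_smul, hf, smul_zero]) = r • P.extMk f
        (n+1) rfl hf := by
  rw [Ext.smul_eq_comp_mk₀, P.extMk_comp_mk₀]
  congr 1

open Abelian in
/-- The map from cocycles to `Abelian.Ext`. -/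
def toNewExt {X : ModuleCat.{0} R} (P : ProjectiveResolution X) (M : ModuleCat.{0} R) (n : ℕ) :
    cocyc P M n →ₗ[R] Ext X M n where
  toFun f := P.extMk f.1 (n+1) rfl f.2
  map_add' f g := (P.add_extMk _ _ _ _ _ _).symm
  map_smul' r f := by
    exact extMk_smul P _ _ _

open Abelian CochainComplex HomComplex in
lemma toNewExt_eq_zero {X : ModuleCat.{0} R} (P : ProjectiveResolution X) (M : ModuleCat.{0} R)
    (n j : ℕ) (hj : (ComplexShape.up ℕ).prev n = j) (f : cocyc P M n) : toNewExt P M n f = 0 ↔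
      ∃ g : P.complex.X j ⟶ M, P.complex.d n j ≫ g = f.1 := by
  obtain ⟨f, hf⟩ := f
  rw [mem_cocyc] at hf
  rcases n with _ | n
  · change P.extMk f 1 rfl hf = 0 ↔ ∃ g : P.complex.X j ⟶ M, P.complex.d 0 j ≫ g = f
    have : P.complex.d 0 j = 0 := by simp
    rw [this]
    constructor
    · intro h
      rw [← P.extEquivCohomologyClass.apply_eq_iff_eq,
        P.extEquivCohomologyClass_extMk, P.extEquivCohomologyClass_zero,
        CohomologyClass.mk_eq_zero_iff, Cocycle.toSingleMk_mem_coboundaries_iff _ _ _ _ _ 1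
            (by lia)] at h
      obtain ⟨g, hg⟩ := h
      have h1 : Limits.IsZero (P.cochainComplex.X 1) := P.cochainComplex.isZero_of_isStrictlyLE 0 1
      rw [h1.eq_of_src g 0, Limits.comp_zero] at hg
      refine ⟨0, ?_⟩
      rw [← cancel_epi (P.cochainComplexXIso (-(0:ℕ)) 0 rfl).hom]
      simpa using hg
    · rintro ⟨g, hg⟩
      obtain rfl : f = 0 := by rw [← hg]; simp
      simp
  · obtain rfl : n = j := by rw [← hj]; simp
    exact P.extMk_eq_zero_iff f (n+2) rfl hf n rfl

lemma toNewExt_surjective {X : ModuleCat.{0} R} (P : ProjectiveResolution X) (M : ModuleCat.{0} R)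
    (n : ℕ) :
    Function.Surjective (toNewExt P M n) := by
  intro y
  obtain ⟨f, hf, rfl⟩ := P.extMk_surjective y (n+1) rfl
  exact ⟨⟨f, hf⟩, rfl⟩

lemma exists_equiv_of_ker_eq {Z A B : Type*} [AddCommGroup Z] [AddCommGroup A] [AddCommGroup B]
    [Module R Z] [Module R A] [Module R B] (α : Z →ₗ[R] A) (β : Z →ₗ[R] B)
        (hα : Function.Surjective α)
    (hβ : Function.Surjective β) (h : ∀ z, α z = 0 ↔ β z = 0) : ∃ e : A ≃ₗ[R] B, ∀ z, e
        (α z) = β z := by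
  have hk : LinearMap.ker α = LinearMap.ker β := by ext z; exact h z
  refine ⟨(α.quotKerEquivOfSurjective hα).symm ≪≫ₗ Submodule.quotEquivOfEq _ _ hk ≪≫ₗ β.quotKerEquivOfSurjective hβ, fun z => ?_⟩
  have : (α.quotKerEquivOfSurjective hα).symm (α z) = Submodule.Quotient.mk z := by
    rw [LinearEquiv.symm_apply_eq]; rfl
  simp [this]

lemma exists_homology_equiv_ext {X : ModuleCat.{0} R} (P : ProjectiveResolution X)
    (M : ModuleCat.{0} R) (n : ℕ) :
    ∃ e : (P.complex.linearYonedaObj R M).homology n ≃ₗ[R] Abelian.Ext X M n,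
      ∀ f : cocyc P M n, e (toHomology (P.complex.linearYonedaObj R M) n f) = toNewExt P M n f :=
  exists_equiv_of_ker_eq (toHomology (P.complex.linearYonedaObj R M) n) (toNewExt P M n)
      (toHomology_surjective _ _) (toNewExt_surjective _ _ _) (fun f => by
    exact (toHomology_eq_zero _ n _ rfl f).trans (toNewExt_eq_zero P M n _ rfl f).symm)

open Abelian in
/-- The two versions of `Ext` are isomorphic, compatibly with precomposition. -/
lemma exists_oldExt_equiv_newExt (M : ModuleCat.{0} R) (n : ℕ) :
    ∃ e : ∀ X : ModuleCat.{0} R, ((_root_.Ext R (ModuleCat.{0} R) n).obj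
        (Opposite.op X)).obj M ≃ₗ[R] Abelian.Ext X M n,
      ∀ (X Y : ModuleCat.{0} R) (f : X ⟶ Y) (z : ((_root_.Ext R (ModuleCat.{0} R) n).obj
          (Opposite.op Y)).obj M),
       e X ((((_root_.Ext R (ModuleCat.{0} R) n).map f.op).app M).hom z) = (Ext.mk₀ f).comp
           (e Y z) (zero_add n) := by
  choose e he using fun X : ModuleCat.{0} R => exists_homology_equiv_ext
      (projectiveResolution X) M n
  refine ⟨fun X => ((projectiveResolution X).isoExt
      (R := R) n M).toLinearEquiv ≪≫ₗ e X, fun X Y f z => ?_⟩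
  have h := congrArg (fun g => g.hom z) (isoExt_hom_naturality f (projectiveResolution X)
      (projectiveResolution Y)
    (ProjectiveResolution.lift f _ _) (ProjectiveResolution.lift_commutes_zero _ _ _) n M)
  change e X ((((projectiveResolution X).isoExt (R := R) n M).hom).hom ((((_root_.Ext R
      (ModuleCat.{0} R) n).map f.op).app M).hom z)) =
     (Ext.mk₀ f).comp (e Y ((((projectiveResolution Y).isoExt (R := R) n M).hom).hom z)) _
  refine (congrArg (e X) h).trans ?_
  change e X ((HomologicalComplex.homologyMap (precompMap _ M) n).hom
      ((((projectiveResolution Y).isoExt (R := R) n M).hom).hom z)) = _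
  generalize (((projectiveResolution Y).isoExt (R := R) n M).hom).hom z = y
  obtain ⟨w, rfl⟩ := toHomology_surjective _ _ y
  let φ : ProjectiveResolution.Hom (projectiveResolution X) (projectiveResolution Y) f :=
   { hom := ProjectiveResolution.lift f _ _
     hom_f_zero_comp_π_f_zero := ProjectiveResolution.lift_commutes_zero _ _ _ }
  have hw : (projectiveResolution X).complex.d (n+1) n ≫ φ.hom.f n ≫ (show
      (projectiveResolution Y).complex.X n ⟶ M from w.1) = 0 := by
    rw [← φ.hom.comm_assoc (n + 1) n, (show (projectiveResolution Y).complex.d (n+1) n ≫ (show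
        (projectiveResolution Y).complex.X n ⟶ M from w.1) = 0 from w.2)]
    simp
  rw [toHomology_naturality _ _ w ⟨((precompMap (ProjectiveResolution.lift f
      (projectiveResolution X) (projectiveResolution Y)) M).f n).hom w.1, hw⟩ rfl]
  erw [he, he]
  exact (ProjectiveResolution.mk₀_comp_extMk w.1 (n+1) rfl w.2 φ).symm

/-- The module `R ⧸ a ^ t`. -/
abbrev quotPow (a : Ideal R) (t : ℕ) : ModuleCat.{0} R := ModuleCat.of R (R ⧸ a ^ t)

/-- The projection `R ⧸ a ^ u ⟶ R ⧸ a ^ t` for `t ≤ u`. -/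
def quotPowProj (a : Ideal R) {t u : ℕ} (h : t ≤ u) : quotPow a u ⟶ quotPow a t :=
  ModuleCat.ofHom (Submodule.mapQ _ _ LinearMap.id (Ideal.pow_le_pow_right h))

lemma quotPowProj_refl (a : Ideal R) (t : ℕ) : quotPowProj a (le_refl t) = 𝟙 _ := by
  ext; rfl

lemma quotPowProj_comp (a : Ideal R) {t u v : ℕ} (h : t ≤ u) (h' : u ≤ v) :
    quotPowProj a h' ≫ quotPowProj a h = quotPowProj a (h.trans h') := by
  ext; rfl

/-- The map on `Ext` induced by the projection `quotPowProj a h`. -/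
def extTrans (a : Ideal R) (M : ModuleCat.{0} R) (i t u : ℕ) (h : t ≤ u) :
    Abelian.Ext (quotPow a t) M i →ₗ[R] Abelian.Ext (quotPow a u) M i :=
  Abelian.Ext.precompOfLinear (Abelian.Ext.mk₀ (quotPowProj a h)) R M (zero_add i)

lemma extTrans_apply (a : Ideal R) (M : ModuleCat.{0} R) (i t u : ℕ) (h : t ≤ u) (x) :
    extTrans a M i t u h x = (Abelian.Ext.mk₀ (quotPowProj a h)).comp x (zero_add i) := rfl

instance (a : Ideal R) (M : ModuleCat.{0} R) (i : ℕ) :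
    DirectedSystem (fun t => Abelian.Ext (quotPow a t) M i)
        (fun t u h => extTrans a M i t u h) where
  map_self t x := by simp [extTrans_apply, quotPowProj_refl]
  map_map t u v h h' x := by
    simp only [extTrans_apply]
    rw [Abelian.Ext.mk₀_comp_mk₀_assoc, quotPowProj_comp]

/-- Local cohomology as the direct limit of the modules `Ext^i(R ⧸ a ^ t, M)`. -/
def LC (a : Ideal R) (i : ℕ) (M : ModuleCat.{0} R) : Type :=
  Module.DirectLimit (fun t => Abelian.Ext (quotPow a t) M i) (extTrans a M i)

instance (a : Ideal R) (i : ℕ) (M : ModuleCat.{0} R) : AddCommGroup (LC a i M) :=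
  inferInstanceAs (AddCommGroup (Module.DirectLimit (fun t => Abelian.Ext (quotPow a t) M i)
      (extTrans a M i)))

instance (a : Ideal R) (i : ℕ) (M : ModuleCat.{0} R) : Module R (LC a i M) :=
  inferInstanceAs (Module R (Module.DirectLimit (fun t => Abelian.Ext (quotPow a t) M i)
      (extTrans a M i)))

/-- The canonical map to the direct limit. -/
def LC.of (a : Ideal R) (i : ℕ) (M : ModuleCat.{0} R) (t : ℕ) : Abelian.Ext
    (quotPow a t) M i →ₗ[R] LC a i M :=
  Module.DirectLimit.of R ℕ (fun t => Abelian.Ext (quotPow a t) M i) (extTrans a M i) t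

lemma LC.of_trans (a : Ideal R) (i : ℕ) (M : ModuleCat.{0} R) {t u : ℕ} (h : t ≤ u) (x) :
    LC.of a i M u (extTrans a M i t u h x) = LC.of a i M t x :=
  Module.DirectLimit.of_f (G := fun t => Abelian.Ext (quotPow a t) M i) (f := extTrans a M i)

lemma LC.exists_of {a : Ideal R} {i : ℕ} {M : ModuleCat.{0} R} (z : LC a i M) :
    ∃ t x, LC.of a i M t x = z := Module.DirectLimit.exists_of z

lemma LC.of_eq_zero {a : Ideal R} {i : ℕ} {M : ModuleCat.{0} R} {t : ℕ} {x}
    (h : LC.of a i M t x = 0) : ∃ u, ∃ h : t ≤ u, extTrans a M i t u h x = 0 :=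
        Module.DirectLimit.of.zero_exact h

open Limits in
lemma nonempty_locCoh_equiv (a : Ideal R) (i : ℕ) (M : Type) [AddCommGroup M] [Module R M] :
    Nonempty (LC a i (ModuleCat.of R M) ≃ₗ[R] (localCohomology a i).obj (ModuleCat.of R M)) := by
  obtain ⟨e, he⟩ := exists_oldExt_equiv_newExt (ModuleCat.of R M) i
  let D := localCohomology.diagram (localCohomology.idealPowersDiagram a) i
  have hD : HasColimit D := localCohomology.hasColimitDiagram.{0, 0} _ i
  let F := D ⋙ (evaluation _ _).obj (ModuleCat.of R M)
  let hc : IsColimit (((evaluation _ _).obj (ModuleCat.of R M)).mapCocone (colimit.cocone D)) :=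
    isColimitOfPreserves _ (colimit.isColimit D)
  let T : ModuleCat.{0} R := (localCohomology a i).obj (ModuleCat.of R M)
  let ι : ∀ t : ℕ, Abelian.Ext (quotPow a t) (ModuleCat.of R M) i →ₗ[R] T := fun t =>
    ((colimit.ι D (Opposite.op (Opposite.op t))).app (ModuleCat.of R M)).hom ∘ₗ (e
        (quotPow a t)).symm.toLinearMap
  have hmap : ∀ (t u : ℕ) (h : t ≤ u) x, F.map (X := Opposite.op (Opposite.op t))
      (Y := Opposite.op (Opposite.op u)) (homOfLE h).op.op ((e (quotPow a t)).symm x) = (e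
          (quotPow a u)).symm (extTrans a _ i t u h x) := by
    intro t u h x
    refine (LinearEquiv.eq_symm_apply (e (quotPow a u))).2 ((he _ _ (quotPowProj a h) _).trans ?_)
    rw [LinearEquiv.apply_symm_apply]
    rfl
  have hιs : ∀ z : T, ∃ t x, ι t x = z := by
    intro z
    obtain ⟨j, y, hy⟩ := Concrete.isColimit_exists_rep F hc z
    refine ⟨j.unop.unop, e _ y, ?_⟩
    refine Eq.trans ?_ hy
    change ((colimit.ι D j).app (ModuleCat.of R M)).hom ((e _).symm (e _ y)) = _
    exact congrArg _ (LinearEquiv.symm_apply_apply (e (quotPow a j.unop.unop)) y)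
  have hι0 : ∀ t u (h : t ≤ u) x, ι u (extTrans a _ i t u h x) = ι t x := by
    intro t u h x
    have := Concrete.isColimit_rep_eq_of_exists F (D := (((evaluation _ _).obj
        (ModuleCat.of R M)).mapCocone (colimit.cocone D))) (i := Opposite.op (Opposite.op u))
            (j := Opposite.op (Opposite.op t))
      ((e (quotPow a u)).symm (extTrans a _ i t u h x)) ((e (quotPow a t)).symm x) ⟨_, 𝟙 _,
          (homOfLE h).op.op, by
        refine Eq.trans ?_ (hmap t u h x).symm
        rw [F.map_id]; rfl⟩
    exact this
  have hιi : ∀ t x, ι t x = 0 → ∃ u, ∃ h : t ≤ u, extTrans a _ i t u h x = 0 := by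
    intro t x h
    obtain ⟨k, f, g, hfg⟩ := Concrete.isColimit_exists_of_rep_eq F hc (i := Opposite.op
        (Opposite.op t)) (j := Opposite.op (Opposite.op t)) ((e (quotPow a t)).symm x) (0 : F.obj _)
      (by refine Eq.trans h ?_; exact (map_zero ((((evaluation _ _).obj
          (ModuleCat.of R M)).mapCocone (colimit.cocone D)).ι.app (Opposite.op
              (Opposite.op t))).hom).symm)
    refine ⟨k.unop.unop, leOfHom f.unop.unop, (e _).symm.injective ?_⟩
    rw [map_zero]
    refine (hmap _ _ _ _).symm.trans ?_
    refine Eq.trans hfg ?_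
    exact map_zero (F.map g).hom
  refine ⟨LinearEquiv.ofBijective (Module.DirectLimit.lift R ℕ _ _ ι hι0) ⟨?_, ?_⟩⟩
  · rw [injective_iff_map_eq_zero]
    intro z hz
    obtain ⟨t, x, rfl⟩ := LC.exists_of z
    obtain ⟨u, h, hu⟩ := hιi t x ((Module.DirectLimit.lift_of ..).symm.trans hz)
    rw [← LC.of_trans _ _ _ h, hu, map_zero]
    rfl
  · intro z
    obtain ⟨t, x, rfl⟩ := hιs z
    exact ⟨LC.of _ _ _ t x, Module.DirectLimit.lift_of ..⟩

/-- The map on local cohomology given by the Yoneda product with an `Ext` class. -/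
def LC.push (a : Ideal R) {M N : ModuleCat.{0} R} {j : ℕ} (β : Abelian.Ext M N j) {i k : ℕ}
    (h : i + j = k) :
    LC a i M →ₗ[R] LC a k N :=
  Module.DirectLimit.map (G := fun t => Abelian.Ext (quotPow a t) M i) (f := extTrans a M i)
    (G' := fun t => Abelian.Ext (quotPow a t) N k) (f' := extTrans a N k)
    (fun t => β.postcompOfLinear R (quotPow a t) h) (by
      intro t u htu
      ext x
      change (Abelian.Ext.comp _ x (zero_add i)).comp β h = Abelian.Ext.comp _ (x.comp β h)
          (zero_add k)
      apply Abelian.Ext.comp_assoc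
      lia)

lemma LC.push_of (a : Ideal R) {M N : ModuleCat.{0} R} {j : ℕ} (β : Abelian.Ext M N j) {i k : ℕ}
    (h : i + j = k)
    (t : ℕ) (x : Abelian.Ext (quotPow a t) M i) :
    LC.push a β h (LC.of a i M t x) = LC.of a k N t (x.comp β h) :=
  Module.DirectLimit.map_apply_of (G := fun t => Abelian.Ext (quotPow a t) M i)
      (f := extTrans a M i)
    (G' := fun t => Abelian.Ext (quotPow a t) N k) (f' := extTrans a N k) _ _ x

lemma LC.push_exact (a : Ideal R) {M N P : ModuleCat.{0} R} {i j j' k l : ℕ} (α : Abelian.Ext M N j)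
    (β : Abelian.Ext N P j') (hα : i + j = k) (hβ : k + j' = l)
    (h0 : α.comp β rfl = 0)
    (hex : ∀ (X : ModuleCat.{0} R) (x : Abelian.Ext X N k), x.comp β hβ = 0 →
        ∃ y : Abelian.Ext X M i, y.comp α hα = x) :
    Function.Exact (LC.push a α hα) (LC.push a β hβ) := by
  intro z
  constructor
  · intro hz
    obtain ⟨t, x, rfl⟩ := LC.exists_of z
    rw [LC.push_of] at hz
    obtain ⟨u, htu, hu⟩ := LC.of_eq_zero hz
    obtain ⟨y, hy⟩ := hex _ (extTrans a N k t u htu x) (by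
      rw [extTrans_apply] at hu ⊢
      rw [Abelian.Ext.comp_assoc]
      · exact hu
      · lia)
    exact ⟨LC.of a i M u y, by rw [LC.push_of, hy, LC.of_trans]⟩
  · rintro ⟨w, rfl⟩
    obtain ⟨t, x, rfl⟩ := LC.exists_of w
    rw [LC.push_of, LC.push_of, Abelian.Ext.comp_assoc _ _ _ _ rfl (by lia), h0,
      Abelian.Ext.comp_zero, map_zero]

/-- Functoriality of local cohomology. -/
def LC.map (a : Ideal R) (i : ℕ) {M N : Type} [AddCommGroup M] [Module R M] [AddCommGroup N]
    [Module R N]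
    (f : M →ₗ[R] N) : LC a i (.of R M) →ₗ[R] LC a i (.of R N) :=
  LC.push a (Abelian.Ext.mk₀ (ModuleCat.ofHom f)) (add_zero i)

section
variable {M N P : Type} [AddCommGroup M] [Module R M] [AddCommGroup N] [Module R N]
    [AddCommGroup P] [Module R P]

lemma LC.map_of (a : Ideal R) (i : ℕ) (f : M →ₗ[R] N) (t : ℕ) (x) :
    LC.map a i f (LC.of a i (.of R M) t x) = LC.of a i (.of R N) t (x.comp (Abelian.Ext.mk₀
        (ModuleCat.ofHom f)) (add_zero i)) :=
  LC.push_of ..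

lemma LC.map_id (a : Ideal R) (i : ℕ) (z) : LC.map a i (LinearMap.id : M →ₗ[R] M) z = z := by
  obtain ⟨t, x, rfl⟩ := LC.exists_of z
  rw [LC.map_of, ModuleCat.ofHom_id, Abelian.Ext.comp_mk₀_id]

lemma LC.map_smul_id (a : Ideal R) (i : ℕ) (r : R) (z) :
    LC.map a i (r • LinearMap.id : M →ₗ[R] M) z = r • z := by
  obtain ⟨t, x, rfl⟩ := LC.exists_of z
  rw [LC.map_of, ← map_smul, Abelian.Ext.smul_eq_comp_mk₀]
  rfl

lemma LC.exists_connecting (a : Ideal R) {f : M →ₗ[R] N} {g : N →ₗ[R] P} (hf : Function.Injective f)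
    (hg : Function.Surjective g) (hfg : Function.Exact f g) (i : ℕ) :
    ∃ δ : LC a i (.of R P) →ₗ[R] LC a (i + 1) (.of R M),
      Function.Exact (LC.map a i g) δ ∧ Function.Exact δ (LC.map a (i + 1) f) := by
  let S : ShortComplex (ModuleCat.{0} R) := ShortComplex.mk (ModuleCat.ofHom f)
      (ModuleCat.ofHom g) (by
    ext x; exact hfg.apply_apply_eq_zero x)
  have hS : S.ShortExact := ModuleCat.shortComplex_shortExact S hfg hf hg
  exact ⟨LC.push a hS.extClass rfl,
    LC.push_exact a (Abelian.Ext.mk₀ S.g) hS.extClass (add_zero i) rfl hS.comp_extClass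
      fun X x hx => Abelian.Ext.covariant_sequence_exact₃ X hS x rfl hx,
    LC.push_exact a hS.extClass (Abelian.Ext.mk₀ S.f) rfl (add_zero _) hS.extClass_comp
      fun X x hx => Abelian.Ext.covariant_sequence_exact₁ X hS x hx rfl⟩

lemma LC.map_exact (a : Ideal R) {f : M →ₗ[R] N} {g : N →ₗ[R] P} (hf : Function.Injective f)
    (hg : Function.Surjective g) (hfg : Function.Exact f g) (i : ℕ) :
    Function.Exact (LC.map a i f) (LC.map a i g) := by
  let S : ShortComplex (ModuleCat.{0} R) := ShortComplex.mk (ModuleCat.ofHom f)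
      (ModuleCat.ofHom g) (by
    ext x; exact hfg.apply_apply_eq_zero x)
  have hS : S.ShortExact := ModuleCat.shortComplex_shortExact S hfg hf hg
  exact LC.push_exact a (Abelian.Ext.mk₀ S.f) (Abelian.Ext.mk₀ S.g) (add_zero i) (add_zero i)
      (by rw [Abelian.Ext.mk₀_comp_mk₀, S.zero, Abelian.Ext.mk₀_zero])
      fun X x hx => Abelian.Ext.covariant_sequence_exact₂ X hS x hx

lemma LC.subsingleton_of_injective (a : Ideal R) (i : ℕ) [Module.Injective R M] :
    Subsingleton (LC a (i + 1) (.of R M)) := by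
  have : Injective (ModuleCat.of R M) := Module.injective_object_of_injective_module R M
  refine subsingleton_of_forall_eq 0 fun z => ?_
  obtain ⟨t, x, rfl⟩ := LC.exists_of z
  rw [Abelian.Ext.eq_zero_of_injective x, map_zero]

lemma LC.exists_pow_smul_eq_zero (a : Ideal R) (i : ℕ) (z : LC a i (.of R M)) :
    ∃ t, ∀ r ∈ a ^ t, r • z = 0 := by
  obtain ⟨t, x, rfl⟩ := LC.exists_of z
  refine ⟨t, fun r hr => ?_⟩
  rw [← map_smul]
  have h0 : r • 𝟙 (quotPow a t) = 0 := by
    ext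
    change r • (Submodule.Quotient.mk 1 : R ⧸ a ^ t) = 0
    rw [← Submodule.Quotient.mk_smul, Submodule.Quotient.mk_eq_zero]
    simpa using hr
  have : r • x = 0 := by
    rw [← Abelian.Ext.mk₀_id_comp x, ← Abelian.Ext.smul_comp, ← Abelian.Ext.mk₀_smul, h0, Abelian.Ext.mk₀_zero, Abelian.Ext.zero_comp]
  rw [this, map_zero]

/-- The `a`-power torsion submodule `Γ_a(M)`. -/
def Gam (a : Ideal R) (M : Type) [AddCommGroup M] [Module R M] : Submodule R M where
  carrier := {m | ∃ t, ∀ r ∈ a ^ t, r • m = 0}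
  zero_mem' := ⟨0, fun r _ => smul_zero r⟩
  add_mem' := by
    rintro x y ⟨t, ht⟩ ⟨u, hu⟩
    refine ⟨t + u, fun r hr => ?_⟩
    rw [smul_add, ht r (Ideal.pow_le_pow_right (by lia) hr), hu r (Ideal.pow_le_pow_right
        (by lia) hr), add_zero]
  smul_mem' := by
    rintro c x ⟨t, ht⟩
    exact ⟨t, fun r hr => by rw [smul_comm, ht r hr, smul_zero]⟩

/-- The map `Ext^0(R ⧸ a ^ t, M) → M` given by evaluation at `1`. -/
def evalOne (a : Ideal R) (M : Type) [AddCommGroup M] [Module R M] (t : ℕ) :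
    Abelian.Ext (quotPow a t) (.of R M) 0 →ₗ[R] M where
  toFun x := (Abelian.Ext.linearEquiv₀ (R := R) x).hom (Submodule.Quotient.mk 1 : R ⧸ a ^ t)
  map_add' x y := by rw [map_add]; rfl
  map_smul' r x := by rw [map_smul]; rfl

lemma evalOne_mk₀ (a : Ideal R) (t : ℕ) (f : quotPow a t ⟶ .of R M) :
    evalOne a M t (Abelian.Ext.mk₀ f) = f.hom (Submodule.Quotient.mk 1 : R ⧸ a ^ t) := by
  have h : Abelian.Ext.linearEquiv₀ (R := R) (Abelian.Ext.mk₀ f) = f :=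
    Abelian.Ext.linearEquiv₀.apply_symm_apply (R := R) f
  exact congrArg (fun g => g.hom (Submodule.Quotient.mk 1 : R ⧸ a ^ t)) h

lemma exists_mk₀ {X Y : ModuleCat.{0} R} (x : Abelian.Ext X Y 0) : ∃ f, x = Abelian.Ext.mk₀ f :=
  ⟨_, (Abelian.Ext.mk₀_addEquiv₀_apply x).symm⟩

/-- The comparison map `H^0_a(M) → M`. -/
def LC.toMod (a : Ideal R) (M : Type) [AddCommGroup M] [Module R M] : LC a 0 (.of R M) →ₗ[R] M :=
  Module.DirectLimit.lift R ℕ (fun t => Abelian.Ext (quotPow a t) (.of R M) 0) (extTrans a _ 0)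
      (evalOne a M) (by
    intro t u h x
    obtain ⟨f, rfl⟩ := exists_mk₀ x
    rw [extTrans_apply, Abelian.Ext.mk₀_comp_mk₀, evalOne_mk₀, evalOne_mk₀]
    rfl)

lemma LC.toMod_of (a : Ideal R) (t) (f : quotPow a t ⟶ .of R M) :
    LC.toMod a M (LC.of a 0 _ t (Abelian.Ext.mk₀ f)) = f.hom
        (Submodule.Quotient.mk 1 : R ⧸ a ^ t) :=
  (Module.DirectLimit.lift_of (G := fun t => Abelian.Ext (quotPow a t) (.of R M) 0)
      (f := extTrans a _ 0) ..).trans (evalOne_mk₀ ..)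

lemma LC.toMod_injective (a : Ideal R) : Function.Injective (LC.toMod a M) := by
  rw [injective_iff_map_eq_zero]
  intro z hz
  obtain ⟨t, x, rfl⟩ := LC.exists_of z
  obtain ⟨f, rfl⟩ := exists_mk₀ x
  rw [LC.toMod_of] at hz
  have : f = 0 := by
    ext
    exact hz
  rw [this, Abelian.Ext.mk₀_zero, map_zero]

lemma LC.range_toMod (a : Ideal R) : LinearMap.range (LC.toMod a M) = Gam a M := by
  ext m
  constructor
  · rintro ⟨z, rfl⟩
    obtain ⟨t, ht⟩ := LC.exists_pow_smul_eq_zero a 0 z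
    exact ⟨t, fun r hr => by rw [← map_smul, ht r hr, map_zero]⟩
  · rintro ⟨t, ht⟩
    refine ⟨LC.of a 0 _ t (Abelian.Ext.mk₀ (ModuleCat.ofHom
      (Submodule.liftQ (a ^ t) (LinearMap.toSpanSingleton R M m) ?_))), ?_⟩
    · intro r hr
      simpa using ht r hr
    · rw [LC.toMod_of]
      change (1 : R) • m = m
      rw [one_smul]

lemma LC.toMod_map (a : Ideal R) (f : M →ₗ[R] N) (z) :
    LC.toMod a N (LC.map a 0 f z) = f (LC.toMod a M z) := by
  obtain ⟨t, x, rfl⟩ := LC.exists_of z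
  obtain ⟨g, rfl⟩ := exists_mk₀ x
  rw [LC.map_of, Abelian.Ext.mk₀_comp_mk₀, LC.toMod_of, LC.toMod_of]
  rfl

lemma toMod_mem_Gam (a : Ideal R) (z : LC a 0 (.of R M)) : LC.toMod a M z ∈ Gam a M := by
  rw [← LC.range_toMod]
  exact ⟨z, rfl⟩

lemma exists_toMod_eq {a : Ideal R} {m : M} (hm : m ∈ Gam a M) : ∃ z, LC.toMod a M z = m := by
  rwa [← LC.range_toMod] at hm

lemma map_mem_Gam {a : Ideal R} (f : M →ₗ[R] N) {m : M} (hm : m ∈ Gam a M) : f m ∈ Gam a N := by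
  obtain ⟨t, ht⟩ := hm
  exact ⟨t, fun r hr => by rw [← map_smul, ht r hr, map_zero]⟩

lemma exists_injective_embedding (R : Type) [CommRing R] (M : Type) [AddCommGroup M] [Module R M] :
    ∃ (I : Type) (_ : AddCommGroup I) (_ : Module R I) (f : M →ₗ[R] I),
      Module.Injective R I ∧ Function.Injective f := by
  let J := Injective.under (ModuleCat.of R M)
  have : Injective (ModuleCat.of R J) := inferInstanceAs (Injective (Injective.under
      (ModuleCat.of R M)))
  exact ⟨J, inferInstance, inferInstance, (Injective.ι (ModuleCat.of R M)).hom,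
    Module.injective_module_of_injective_object R J,
        (ModuleCat.mono_iff_injective _).1 inferInstance⟩

lemma exists_pow_forall_of_fg {a : Ideal R} (N : Submodule R M) (hN : N.FG) (h : N ≤ Gam a M) :
    ∃ t, ∀ r ∈ a ^ t, ∀ m ∈ N, r • m = 0 := by
  obtain ⟨s, rfl⟩ := hN
  choose! t ht using fun m (hm : m ∈ s) => h (Submodule.subset_span hm)
  refine ⟨s.sup t, fun r hr m hm => ?_⟩
  induction hm using Submodule.span_induction with
  | mem x hx => exact ht x hx r (Ideal.pow_le_pow_right (Finset.le_sup hx) hr)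
  | zero => exact smul_zero r
  | add x y _ _ hx hy => rw [smul_add, hx, hy, add_zero]
  | smul c x _ hx => rw [smul_comm, hx, smul_zero]

instance injective_Gam [IsNoetherianRing R] (a : Ideal R)
    [Module.Injective R M] : Module.Injective R (Gam a M) := by
  apply Module.Baer.injective
  intro b φ
  obtain ⟨t, ht⟩ := exists_pow_forall_of_fg (a := a) (LinearMap.range φ)
      ((Module.Finite.iff_fg).1 inferInstance) (by
    intro m _
    obtain ⟨t, ht⟩ := m.2
    exact ⟨t, fun r hr => Subtype.ext (ht r hr)⟩)
  obtain ⟨k, hk⟩ := Ideal.exists_pow_inf_eq_pow_smul a b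
  have h1 : a ^ (k + t) ⊓ b ≤ a ^ t • b := by
    have := hk (k + t) (by lia)
    rw [smul_eq_mul, Ideal.mul_top] at this
    rw [this, Nat.add_sub_cancel_left]
    exact Submodule.smul_mono le_rfl inf_le_right
  have hφ : ∀ x (hx : x ∈ b), x ∈ a ^ t • b → φ ⟨x, hx⟩ = 0 := by
    have : ∀ x ∈ a ^ t • b, ∀ hx : x ∈ b, φ ⟨x, hx⟩ = 0 := by
      intro x hx
      refine Submodule.smul_induction_on' hx ?_ ?_
      · intro r hr y hy hb
        have : (⟨r • y, hb⟩ : b) = r • ⟨y, hy⟩ := rfl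
        rw [this, map_smul]
        exact ht r hr _ ⟨_, rfl⟩
      · intro x hx y hy h h' hb
        have hxb := (Submodule.smul_le_right (I := a ^ t) (N := b)) hx
        have hyb := (Submodule.smul_le_right (I := a ^ t) (N := b)) hy
        have : (⟨x + y, hb⟩ : b) = ⟨x, hxb⟩ + ⟨y, hyb⟩ := rfl
        rw [this, map_add, h, h', add_zero]
    exact fun x hx h => this x h hx
  let q : b →ₗ[R] R ⧸ a ^ (k + t) := (Submodule.mkQ (a ^ (k + t))) ∘ₗ b.subtype
  have hq : LinearMap.ker q ≤ LinearMap.ker ((Gam a M).subtype ∘ₗ φ) := by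
    intro x hx
    have hx' : (x : R) ∈ a ^ (k + t) := by
      rwa [LinearMap.mem_ker, LinearMap.comp_apply, Submodule.mkQ_apply, Submodule.Quotient.mk_eq_zero] at hx
    simpa using hφ x x.2 (h1 ⟨hx', x.2⟩)
  let q' : (b ⧸ LinearMap.ker q) →ₗ[R] R ⧸ a ^ (k + t) := (LinearMap.ker q).liftQ q le_rfl
  have hq' : Function.Injective q' := by
    rw [← LinearMap.ker_eq_bot]
    exact Submodule.ker_liftQ_eq_bot' _ _ rfl
  obtain ⟨ψ, hψ⟩ := (Module.Baer.of_injective (R := R)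
      (Q := M) inferInstance).extension_property q' hq'
    ((LinearMap.ker q).liftQ ((Gam a M).subtype ∘ₗ φ) hq)
  refine ⟨LinearMap.codRestrict (Gam a M) (ψ ∘ₗ Submodule.mkQ _) fun c => ?_, fun x hx => ?_⟩
  · refine ⟨k + t, fun r hr => ?_⟩
    rw [← map_smul]
    have : (Submodule.mkQ (a ^ (k + t))) (r • c) = 0 := by
      rw [Submodule.mkQ_apply, Submodule.Quotient.mk_eq_zero]
      exact Ideal.mul_mem_right _ _ hr
    rw [LinearMap.comp_apply, this, map_zero]
  · apply Subtype.ext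
    exact LinearMap.congr_fun hψ (Submodule.Quotient.mk ⟨x, hx⟩)

lemma subsingleton_LC_one (a : Ideal R) {f : M →ₗ[R] N} {g : N →ₗ[R] P} (hf : Function.Injective f)
    (hg : Function.Surjective g) (hfg : Function.Exact f g) (hN : Subsingleton (LC a 1 (.of R N)))
    (h : ∀ y ∈ Gam a P, ∃ x ∈ Gam a N, g x = y) : Subsingleton (LC a 1 (.of R M)) := by
  refine subsingleton_of_forall_eq 0 fun z => ?_
  obtain ⟨δ, h1, h2⟩ := LC.exists_connecting a hf hg hfg 0
  obtain ⟨w, rfl⟩ := (h2 z).1 (hN.elim _ _)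
  obtain ⟨n, hn, hnw⟩ := h _ (toMod_mem_Gam a w)
  obtain ⟨v, rfl⟩ := exists_toMod_eq hn
  rw [← LC.toMod_map] at hnw
  exact (h1 w).2 ⟨v, LC.toMod_injective a hnw⟩

lemma subsingleton_LC_of_Gam_eq_top [IsNoetherianRing R] (a : Ideal R) (i : ℕ) :
    ∀ (M : Type) [AddCommGroup M] [Module R M], Gam a M = ⊤ → Subsingleton (LC a (i + 1)
        (.of R M)) := by
  induction i with
  | zero =>
    intro M _ _ hM
    obtain ⟨I, _, _, f, hI, hf⟩ := exists_injective_embedding R M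
    let f' : M →ₗ[R] Gam a I := f.codRestrict _ fun m => map_mem_Gam f (hM ▸ Submodule.mem_top)
    refine subsingleton_LC_one a (f := f') (g := (LinearMap.range f').mkQ)
      (fun x y h => hf (congrArg Subtype.val h)) (Submodule.mkQ_surjective _)
          (LinearMap.exact_map_mkQ_range f') (LC.subsingleton_of_injective a 0) ?_
    intro y _
    obtain ⟨x, rfl⟩ := Submodule.mkQ_surjective _ y
    obtain ⟨t, ht⟩ := x.2
    exact ⟨x, ⟨t, fun r hr => Subtype.ext (ht r hr)⟩, rfl⟩
  | succ i ih =>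
    intro M _ _ hM
    obtain ⟨I, _, _, f, hI, hf⟩ := exists_injective_embedding R M
    let f' : M →ₗ[R] Gam a I := f.codRestrict _ fun m => map_mem_Gam f (hM ▸ Submodule.mem_top)
    obtain ⟨δ, -, h2⟩ := LC.exists_connecting a (f := f') (g := (LinearMap.range f').mkQ)
      (fun x y h => hf (congrArg Subtype.val h)) (Submodule.mkQ_surjective _)
          (LinearMap.exact_map_mkQ_range f') (i + 1)
    refine subsingleton_of_forall_eq 0 fun z => ?_
    obtain ⟨w, rfl⟩ := (h2 z).1 ((LC.subsingleton_of_injective a (i + 1)).elim _ _)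
    have := ih (Gam a I ⧸ LinearMap.range f') (by
      rw [eq_top_iff]
      intro y _
      obtain ⟨x, rfl⟩ := Submodule.mkQ_surjective _ y
      obtain ⟨t, ht⟩ := x.2
      exact map_mem_Gam _ ⟨t, fun r hr => Subtype.ext (ht r hr)⟩)
    rw [Subsingleton.elim w 0, map_zero]

lemma exists_smul_eq_mk (S : Submonoid R) (y : LocalizedModule S M) :
    ∃ s ∈ S, ∃ x : M, s • y = LocalizedModule.mk x 1 := by
  induction y using LocalizedModule.induction_on with
  | h x s => exact ⟨s, s.2, x, by
      rw [LocalizedModule.smul'_mk, ← LocalizedModule.mk_cancel (s := s) x]; rfl⟩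

lemma mk_one_eq_iff (S : Submonoid R) {x y : M} :
    LocalizedModule.mk x (1 : S) = LocalizedModule.mk y 1 ↔ ∃ s ∈ S, s • x = s • y := by
  rw [LocalizedModule.mk_eq]
  constructor
  · rintro ⟨u, hu⟩
    exact ⟨u, u.2, by simpa [Submonoid.smul_def] using hu⟩
  · rintro ⟨u, hu, h⟩
    exact ⟨⟨u, hu⟩, by simpa [Submonoid.smul_def] using h⟩

lemma mk_one_mem_Gam (S : Submonoid R) (a : Ideal R) {x : M} (hx : x ∈ Gam a M) :
    LocalizedModule.mk x (1 : S) ∈ Gam (a.map (algebraMap R (Localization S)))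
        (LocalizedModule S M) := by
  obtain ⟨t, ht⟩ := hx
  refine ⟨t, fun r hr => ?_⟩
  rw [← Ideal.map_pow] at hr
  induction hr using Submodule.span_induction with
  | mem y hy =>
    obtain ⟨c, hc, rfl⟩ := hy
    rw [algebraMap_smul, LocalizedModule.smul'_mk, ht c hc, LocalizedModule.zero_mk]
  | zero => exact zero_smul ..
  | add x y _ _ hx hy => rw [add_smul, hx, hy, add_zero]
  | smul c x _ hx => rw [smul_eq_mul, mul_smul, hx, smul_zero]

lemma exists_smul_forall_fg (S : Submonoid R) (b : Ideal R) (hb : b.FG) (x : M)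
    (h : ∀ r ∈ b, ∃ s ∈ S, s • r • x = 0) : ∃ s ∈ S, ∀ r ∈ b, s • r • x = 0 := by
  obtain ⟨T, rfl⟩ := hb
  choose! s hs hs' using fun r (hr : r ∈ T) => h r (Submodule.subset_span hr)
  refine ⟨∏ r ∈ T, s r, S.prod_mem hs, fun r hr => ?_⟩
  induction hr using Submodule.span_induction with
  | mem y hy =>
    obtain ⟨c, hc⟩ := Finset.dvd_prod_of_mem s hy
    rw [hc, mul_comm, mul_smul, hs' y hy, smul_zero]
  | zero => rw [zero_smul, smul_zero]
  | add x y _ _ hx hy => rw [add_smul, smul_add, hx, hy, add_zero]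
  | smul c x _ hx => rw [smul_eq_mul, mul_smul, smul_comm, hx, smul_zero]

lemma exists_smul_eq_mk_of_mem_Gam [IsNoetherianRing R] (S : Submonoid R) (a : Ideal R)
    {y : LocalizedModule S M}
    (hy : y ∈ Gam (a.map (algebraMap R (Localization S))) (LocalizedModule S M)) :
    ∃ s ∈ S, ∃ x ∈ Gam a M, s • y = LocalizedModule.mk x 1 := by
  obtain ⟨s, hs, x, hx⟩ := exists_smul_eq_mk S y
  obtain ⟨t, ht⟩ := hy
  obtain ⟨u, hu, hux⟩ := exists_smul_forall_fg S (a ^ t)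
      (IsNoetherian.noetherian _) x fun r hr => by
    have h1 : LocalizedModule.mk (r • x) (1 : S) = LocalizedModule.mk 0 1 := by
      rw [← LocalizedModule.smul'_mk, ← hx, smul_comm, ← algebraMap_smul (Localization S) r y,
        ht _ (by rw [← Ideal.map_pow]; exact Ideal.mem_map_of_mem _ hr), smul_zero, LocalizedModule.zero_mk]
    obtain ⟨v, hv, h⟩ := (mk_one_eq_iff S).1 h1
    exact ⟨v, hv, by rw [h, smul_zero]⟩
  refine ⟨u * s, S.mul_mem hu hs, u • x, ⟨t, fun r hr => by rw [smul_comm, hux r hr]⟩, ?_⟩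
  rw [mul_smul, hx, LocalizedModule.smul'_mk]

lemma exists_mem_Gam_of_map_eq_mk [IsNoetherianRing R] (S : Submonoid R) (a : Ideal R)
    (g : N →ₗ[R] P)
    {y : LocalizedModule S N} (hy : y ∈ Gam (a.map (algebraMap R (Localization S)))
        (LocalizedModule S N)) {z : P}
    (h : LocalizedModule.map S g y = LocalizedModule.mk z 1) :
    ∃ u ∈ S, ∃ x ∈ Gam a N, g x = u • z := by
  obtain ⟨s, hs, x, hx, hsx⟩ := exists_smul_eq_mk_of_mem_Gam S a hy
  have h4 : LocalizedModule.mk (g x) (1 : S) = LocalizedModule.mk (s • z) 1 := by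
    rw [← LocalizedModule.smul'_mk, ← h, ← LinearMap.map_smul_of_tower, hsx, LocalizedModule.map_mk]
  obtain ⟨u, hu, h5⟩ := (mk_one_eq_iff S).1 h4
  exact ⟨u * s, S.mul_mem hu hs, u • x, Submodule.smul_mem _ u hx, by rw [map_smul, h5, mul_smul]⟩

set_option maxHeartbeats 1600000 in
lemma LC.exists_smul_smul_eq_zero [IsNoetherianRing R] (S : Submonoid R) (a : Ideal R) (r : R)
    (i : ℕ) :
    ∀ (M : Type) [AddCommGroup M] [Module R M],
      (∀ z : LC (a.map (algebraMap R (Localization S))) i (.of _ (LocalizedModule S M)),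
        algebraMap R (Localization S) r • z = 0) →
      ∀ z : LC a i (.of R M), ∃ s ∈ S, s • r • z = 0 := by
  induction i with
  | zero =>
    intro M _ _ h z
    obtain ⟨w, hw⟩ := exists_toMod_eq (mk_one_mem_Gam S a (toMod_mem_Gam a z))
    have h1 := congrArg (LC.toMod _ _) (h w)
    rw [map_smul, hw, map_zero, algebraMap_smul, LocalizedModule.smul'_mk, ← LocalizedModule.zero_mk 1,
      mk_one_eq_iff] at h1
    obtain ⟨s, hs, h2⟩ := h1
    refine ⟨s, hs, LC.toMod_injective a ?_⟩
    rw [map_smul, map_smul, h2, smul_zero, map_zero]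
  | succ i ih =>
    intro M _ _ h z
    obtain ⟨I, _, _, f, hI, hf⟩ := exists_injective_embedding R M
    let g := (LinearMap.range f).mkQ
    have hg : Function.Surjective g := Submodule.mkQ_surjective _
    have hfg : Function.Exact f g := LinearMap.exact_map_mkQ_range f
    have hIS : Module.Injective (Localization S) (LocalizedModule S I) :=
      Module.injective_of_isLocalizedModule S (LocalizedModule.mkLinearMap S I)
    obtain ⟨δ, h1, h2⟩ := LC.exists_connecting a hf hg hfg i
    obtain ⟨δ', h1', h2'⟩ := LC.exists_connecting (a.map (algebraMap R (Localization S)))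
      (LocalizedModule.map_injective S f hf) (LocalizedModule.map_surjective S g hg)
          (LocalizedModule.map_exact S f g hfg) i
    obtain ⟨w, rfl⟩ := (h2 z).1 ((LC.subsingleton_of_injective a i).elim _ _)
    have key : ∀ w', ∃ v, LC.map _ i (LocalizedModule.map S g) v = algebraMap R
        (Localization S) r • w' := fun w' =>
      (h1' _).1 (by rw [map_smul, h])
    cases i with
    | zero =>
      obtain ⟨w', hw'⟩ := exists_toMod_eq (mk_one_mem_Gam S a (toMod_mem_Gam a w))
      obtain ⟨v, hv⟩ := key w'
      have h3 := congrArg (LC.toMod _ _) hv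
      rw [LC.toMod_map, map_smul, hw', algebraMap_smul, LocalizedModule.smul'_mk] at h3
      obtain ⟨u, hu, x, hx, h5⟩ := exists_mem_Gam_of_map_eq_mk S a g (toMod_mem_Gam _ v) h3
      obtain ⟨v', rfl⟩ := exists_toMod_eq hx
      have h6 : LC.map a 0 g v' = u • r • w := by
        apply LC.toMod_injective a
        rw [LC.toMod_map, LinearMap.map_smul (LC.toMod a _), LinearMap.map_smul (LC.toMod a _), h5]
      refine ⟨u, hu, ?_⟩
      rw [← LinearMap.map_smul δ, ← LinearMap.map_smul δ, h1]
      exact ⟨_, h6⟩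
    | succ i =>
      obtain ⟨s, hs, h3⟩ := ih _ (fun w' => by
        obtain ⟨v, hv⟩ := key w'
        rw [← hv, (LC.subsingleton_of_injective _ i).elim v 0, map_zero]) w
      exact ⟨s, hs, by rw [← map_smul, ← map_smul, h3, map_zero]⟩

end

/-- `M` is finitely generated up to a module whose support avoids `X`. -/
def FGAway (X : Set (PrimeSpectrum R)) (M : Type) [AddCommGroup M] [Module R M] : Prop :=
  ∃ N : Submodule R M, N.FG ∧ ∀ p ∈ X, ∀ m : M, ∃ s ∉ p.asIdeal, s • m ∈ N

section
variable {X : Set (PrimeSpectrum R)}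
variable {M N P : Type} [AddCommGroup M] [Module R M] [AddCommGroup N] [Module R N]
    [AddCommGroup P] [Module R P]

lemma FGAway.of_finite [Module.Finite R M] : FGAway X M :=
  ⟨⊤, Module.Finite.fg_top, fun p _ _ => ⟨1, p.isPrime.one_notMem, Submodule.mem_top⟩⟩

lemma FGAway.of_injective [IsNoetherianRing R] (h : FGAway X N) (f : M →ₗ[R] N)
    (hf : Function.Injective f) : FGAway X M := by
  obtain ⟨L, hL, h⟩ := h
  have : Module.Finite R L := Module.Finite.iff_fg.2 hL
  refine ⟨L.comap f, ?_, fun p hp m => ?_⟩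
  swap
  · obtain ⟨s, hs, hm⟩ := h p hp (f m)
    exact ⟨s, hs, by rwa [Submodule.mem_comap, map_smul]⟩
  rw [← Module.Finite.iff_fg]
  refine Module.Finite.of_injective (f.restrict (p := L.comap f) (q :=
      L) fun m hm => hm) fun x y hxy => ?_
  exact Subtype.ext (hf (congrArg Subtype.val hxy))

lemma FGAway.of_surjective (h : FGAway X M) (f : M →ₗ[R] N)
    (hf : Function.Surjective f) : FGAway X N := by
  obtain ⟨L, hL, h⟩ := h
  refine ⟨L.map f, hL.map f, fun p hp n => ?_⟩
  obtain ⟨m, rfl⟩ := hf n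
  obtain ⟨s, hs, hm⟩ := h p hp m
  exact ⟨s, hs, s • m, hm, map_smul f s m⟩

lemma FGAway.of_exact [IsNoetherianRing R] (hM : FGAway X M) (hP : FGAway X P) (f : M →ₗ[R] N)
    (g : N →ₗ[R] P)
    (hfg : Function.Exact f g) : FGAway X N := by
  obtain ⟨L, hL, h⟩ := hM
  obtain ⟨K, hK, h'⟩ := hP.of_injective (LinearMap.range g).subtype Subtype.val_injective
  have hr := g.surjective_rangeRestrict
  obtain ⟨K', hK', rfl⟩ : ∃ K' : Submodule R N, K'.FG ∧ K'.map g.rangeRestrict = K := by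
    obtain ⟨S, rfl⟩ := hK
    classical
    refine ⟨Submodule.span R (S.image (Function.surjInv hr) : Finset N), ⟨_, rfl⟩, ?_⟩
    rw [Submodule.map_span, Finset.coe_image, ← Set.image_comp]
    have : (g.rangeRestrict ∘ Function.surjInv hr) = id := funext (Function.surjInv_eq hr)
    rw [this, Set.image_id]
  refine ⟨L.map f ⊔ K', (hL.map f).sup hK', fun p hp n => ?_⟩
  obtain ⟨s, hs, k, hk, hsk⟩ := h' p hp (g.rangeRestrict n)
  have h1 : g (s • n - k) = 0 := by
    have : g k = s • g n := congrArg Subtype.val hsk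
    rw [map_sub, map_smul, this, sub_self]
  obtain ⟨m, hm⟩ := (hfg _).1 h1
  obtain ⟨u, hu, hum⟩ := h p hp m
  refine ⟨u * s, fun h => (p.isPrime.mem_or_mem h).elim hu hs, ?_⟩
  have : (u * s) • n = f (u • m) + u • k := by
    rw [map_smul, hm, smul_sub, mul_smul, sub_add_cancel]
  rw [this]
  exact add_mem (Submodule.mem_sup_left ⟨_, hum, rfl⟩) (Submodule.mem_sup_right (K'.smul_mem u hk))

lemma FGAway.inDimLT {n : ℕ} (h : FGAway {p : PrimeSpectrum R | (n : WithBot ℕ∞) ≤ ringKrullDim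
    (R ⧸ p.asIdeal)} M) :
    ∃ N : Submodule R M, N.FG ∧ Order.krullDim (Module.support R (M ⧸ N)) < (n : WithBot ℕ∞) := by
  obtain ⟨N, hN, h⟩ := h
  refine ⟨N, hN, Order.krullDim_lt_coe_iff.2 fun l => ?_⟩
  by_contra! hl
  have h0 : l.head.1 ∉ Module.support R (M ⧸ N) := by
    rw [Module.notMem_support_iff']
    intro m
    obtain ⟨m, rfl⟩ := Submodule.mkQ_surjective N m
    obtain ⟨s, hs, hm⟩ := h l.head.1 (by
      rw [Set.mem_ofPred_eq, ringKrullDim_quotient]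
      let l' : LTSeries (PrimeSpectrum.zeroLocus (R := R) l.head.1.asIdeal) :=
        { length := l.length
          toFun := fun i => ⟨(l i).1, l.head_le i⟩
          step := fun i => l.step i }
      exact (Nat.cast_le.2 hl).trans (Order.LTSeries.length_le_krullDim l')) m
    exact ⟨s, hs, by rwa [← map_smul, Submodule.mkQ_apply, Submodule.Quotient.mk_eq_zero]⟩
  exact h0 l.head.2

/-- Multiplication by `x` as a linear map. -/
abbrev mulMap (M : Type) [AddCommGroup M] [Module R M] (x : R) : M →ₗ[R] M := LinearMap.lsmul R M x

lemma FGAway.ker_pow [IsNoetherianRing R] {x : R} (h : FGAway X (LinearMap.ker (mulMap M x)))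
    (k : ℕ) :
    FGAway X (LinearMap.ker (mulMap M (x ^ k))) := by
  induction k with
  | zero =>
    refine h.of_injective (Submodule.inclusion fun m hm => ?_) (Submodule.inclusion_injective _)
    have : m = 0 := by simpa using hm
    simp [this]
  | succ k ih =>
    refine FGAway.of_exact h ih
      (Submodule.inclusion (p := LinearMap.ker (mulMap M x)) (p' := LinearMap.ker (mulMap M (x ^
          (k + 1)))) fun m hm => ?_)
      ((mulMap M x).restrict (p := LinearMap.ker (mulMap M (x ^ (k + 1)))) (q := LinearMap.ker
          (mulMap M (x ^ k))) fun m hm => ?_)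
      fun m => ?_
    · have hm : x • m = 0 := hm
      change x ^ (k + 1) • m = 0
      rw [pow_succ, mul_smul, hm, smul_zero]
    · change x ^ k • x • m = 0
      rw [← mul_smul, ← pow_succ]
      exact hm
    · constructor
      · intro hm
        exact ⟨⟨m, congrArg Subtype.val hm⟩, rfl⟩
      · rintro ⟨m, rfl⟩
        exact Subtype.ext m.2

lemma exists_ann_eq_of_le [IsNoetherianRing R] (y : M) (p : Ideal R) [p.IsPrime]
    (h : ∀ s, s • y = 0 → s ∈ p) :
    ∃ q ≤ p, q.IsPrime ∧ ∃ r : R, ∀ s, s ∈ q ↔ s • r • y = 0 := by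
  let L := Submodule.span R {y}
  obtain ⟨q, hq, hqp⟩ := Ideal.exists_minimalPrimes_le (I := Module.annihilator R L) (J := p) (by
    intro s hs
    exact h s (by simpa [L] using Module.mem_annihilator.1 hs ⟨y, Submodule.mem_span_singleton_self y⟩))
  obtain ⟨hqp', z, hz⟩ := isAssociatedPrime_iff.1
      (Module.associatedPrimes.minimalPrimes_annihilator_subset_associatedPrimes R L hq)
  obtain ⟨r, hr⟩ := Submodule.mem_span_singleton.1 z.2
  refine ⟨q, hqp, hqp', r, fun s => ?_⟩
  rw [hz, Submodule.mem_colon_singleton, Submodule.mem_bot, ← Submodule.coe_eq_zero, Submodule.coe_smul, hr]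

lemma FGAway.of_ker [IsNoetherianRing R] (hX : ∀ p q : PrimeSpectrum R, q ≤ p → p ∈ X → q ∈ X)
    {x : R}
    (htors : ∀ m : M, ∃ k, x ^ k • m = 0) (hker : FGAway X (LinearMap.ker (mulMap M x)))
    (hloc : ∀ p ∈ X, ∃ t, ∀ m : M, ∃ s ∉ p.asIdeal, s • x ^ t • m = 0) : FGAway X M := by
  choose! t ht using hloc
  obtain ⟨L, hL, h⟩ := id hker
  have : Module.Finite R L := Module.Finite.iff_fg.2 hL
  let A : Set (PrimeSpectrum R) := {q | q ∈ X ∧ ∃ y : M, ∀ s, s ∈ q.asIdeal ↔ s • y = 0}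
  have hA : A.Finite := by
    refine Set.Finite.of_finite_image (f := PrimeSpectrum.asIdeal)
        ((associatedPrimes.finite R L).subset ?_)
      (fun p _ q _ h => PrimeSpectrum.ext h)
    rintro _ ⟨q, ⟨hq, y, hy⟩, rfl⟩
    obtain ⟨k, hk⟩ := htors y
    have hx : x • y = 0 := (hy x).1 (q.isPrime.mem_of_pow_mem k ((hy _).2 hk))
    obtain ⟨s, hs, hsy⟩ := h q hq ⟨y, hx⟩
    refine isAssociatedPrime_iff.2 ⟨q.isPrime, ⟨_, hsy⟩, ?_⟩
    ext r
    rw [Submodule.mem_colon_singleton, Submodule.mem_bot]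
    have : r • (⟨s • ⟨y, hx⟩, hsy⟩ : L) = 0 ↔ (r * s) • y = 0 := by
      rw [← Submodule.coe_eq_zero, ← Submodule.coe_eq_zero, mul_smul]
      rfl
    rw [this, ← hy]
    exact ⟨fun hr => q.asIdeal.mul_mem_right _ hr, fun hr =>
        (q.isPrime.mem_or_mem hr).resolve_right hs⟩
  obtain ⟨T, hT⟩ := (hA.image t).bddAbove
  have key : ∀ p ∈ X, ∀ m : M, ∃ s ∉ p.asIdeal, s • x ^ T • m = 0 := by
    intro p hp m
    by_contra! hcon
    obtain ⟨q, hqp, hq, r, hr⟩ := exists_ann_eq_of_le (x ^ T • m) p.asIdeal fun s hs => by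
      by_contra h'
      exact hcon s h' hs
    have hqX : (⟨q, hq⟩ : PrimeSpectrum R) ∈ X := hX p _ hqp hp
    have hle : t ⟨q, hq⟩ ≤ T := hT ⟨_, ⟨hqX, _, hr⟩, rfl⟩
    obtain ⟨s, hs, hs'⟩ := ht _ hqX m
    refine hs ((hr s).2 ?_)
    rw [smul_comm s r, ← Nat.sub_add_cancel hle, pow_add, mul_smul, smul_comm s, hs', smul_zero, smul_zero]
  refine FGAway.of_exact (hker.ker_pow T) (P := LinearMap.range (mulMap M (x ^ T)))
    ⟨⊥, Submodule.fg_bot, fun p hp m => ?_⟩ (Submodule.subtype _) (mulMap M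
        (x ^ T)).rangeRestrict fun m => ?_
  · obtain ⟨_, m, rfl⟩ := m
    obtain ⟨s, hs, hsm⟩ := key p hp m
    exact ⟨s, hs, (Submodule.mem_bot R).2 (Subtype.ext hsm)⟩
  · rw [← LinearMap.mem_ker, LinearMap.ker_rangeRestrict]
    simp

end

section
variable {M N P : Type} [AddCommGroup M] [Module R M] [AddCommGroup N] [Module R N]
    [AddCommGroup P] [Module R P]

lemma LC.finite_of_exact [IsNoetherianRing R] (a : Ideal R) {f : M →ₗ[R] N} {g : N →ₗ[R] P}
    (hf : Function.Injective f) (hg : Function.Surjective g) (hfg : Function.Exact f g) (i : ℕ)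
    (hN : Module.Finite R (LC a i (.of R N))) (hM : Module.Finite R (LC a (i + 1) (.of R M))) :
    Module.Finite R (LC a i (.of R P)) := by
  obtain ⟨δ, h, -⟩ := LC.exists_connecting a hf hg hfg i
  have := isNoetherian_of_range_eq_ker (LC.map a i g) δ h.linearMap_ker_eq.symm
  infer_instance

/-- The `i`-th local cohomology of the localization of `M` at each prime in `X` is finitely
generated. -/
def LocFin (X : Set (PrimeSpectrum R)) (a : Ideal R) (i : ℕ) (M : Type) [AddCommGroup M]
    [Module R M] : Prop :=
  ∀ p ∈ X, Module.Finite (Localization p.asIdeal.primeCompl)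
    (LC (a.map (algebraMap R (Localization p.asIdeal.primeCompl))) i
      (.of _ (LocalizedModule p.asIdeal.primeCompl M)))

variable {X : Set (PrimeSpectrum R)}

lemma LocFin.of_exact [IsNoetherianRing R] {a : Ideal R} {f : M →ₗ[R] N} {g : N →ₗ[R] P}
    (hf : Function.Injective f) (hg : Function.Surjective g) (hfg : Function.Exact f g) {i : ℕ}
    (hN : LocFin X a i N) (hM : LocFin X a (i + 1) M) : LocFin X a i P := fun p hp =>
  have := IsLocalization.isNoetherianRing p.asIdeal.primeCompl
      (Localization p.asIdeal.primeCompl) ‹_›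
  LC.finite_of_exact _ (LocalizedModule.map_injective _ f hf)
      (LocalizedModule.map_surjective _ g hg)
    (LocalizedModule.map_exact _ f g hfg) i (hN p hp) (hM p hp)

lemma LocFin.of_Gam_eq_top [IsNoetherianRing R] {a : Ideal R} (h : Gam a M = ⊤) (i : ℕ) :
    LocFin X a (i + 1) M := fun p hp => by
  have := IsLocalization.isNoetherianRing p.asIdeal.primeCompl
      (Localization p.asIdeal.primeCompl) ‹_›
  have := subsingleton_LC_of_Gam_eq_top (a.map (algebraMap R (Localization p.asIdeal.primeCompl))) i
    (LocalizedModule p.asIdeal.primeCompl M) (eq_top_iff.2 fun y _ => by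
      obtain ⟨s, hs, x, hx⟩ := exists_smul_eq_mk _ y
      obtain ⟨t, ht⟩ := mk_one_mem_Gam p.asIdeal.primeCompl a (x := x) (h ▸ Submodule.mem_top)
      refine ⟨t, fun r hr => ?_⟩
      have h1 := ht r hr
      rw [← hx, smul_comm] at h1
      have hu := IsLocalization.map_units (Localization p.asIdeal.primeCompl) ⟨s, hs⟩
      rwa [← algebraMap_smul (Localization p.asIdeal.primeCompl) s, hu.smul_eq_zero] at h1)
  infer_instance

lemma Gam_Gam (a : Ideal R) : Gam a (Gam a M) = ⊤ :=
  eq_top_iff.2 fun m _ => by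
    obtain ⟨t, ht⟩ := m.2
    exact ⟨t, fun r hr => Subtype.ext (ht r hr)⟩

lemma Gam_quotient_Gam [IsNoetherianRing R] (a : Ideal R) : Gam a (M ⧸ Gam a M) = ⊥ := by
  refine eq_bot_iff.2 fun y hy => ?_
  obtain ⟨m, rfl⟩ := Submodule.mkQ_surjective _ y
  obtain ⟨t, ht⟩ := hy
  simp_rw [← map_smul, Submodule.mkQ_apply, Submodule.Quotient.mk_eq_zero] at ht
  have hfg : ((a ^ t) • Submodule.span R {m}).FG :=
    Submodule.FG.smul (IsNoetherian.noetherian _) ⟨{m}, by simp⟩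
  obtain ⟨u, hu⟩ := exists_pow_forall_of_fg (a := a) _ hfg (by
    rw [Submodule.smul_le]
    intro r hr n hn
    obtain ⟨c, rfl⟩ := Submodule.mem_span_singleton.1 hn
    rw [smul_comm]
    exact Submodule.smul_mem _ _ (ht r hr))
  rw [Submodule.mem_bot, Submodule.mkQ_apply, Submodule.Quotient.mk_eq_zero]
  refine ⟨u + t, fun r hr => ?_⟩
  rw [pow_add] at hr
  refine Submodule.mul_induction_on hr (fun r hr s hs => ?_) fun r s hr hs => by rw
      [add_smul, hr, hs, add_zero]
  rw [mul_smul]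
  exact hu r hr _ (Submodule.smul_mem_smul hs (Submodule.mem_span_singleton_self m))

lemma exists_mem_injective_mulMap [IsNoetherianRing R] [Module.Finite R M] {a : Ideal R}
    (h : Gam a M = ⊥) :
    ∃ x ∈ a, Function.Injective (mulMap M x) := by
  by_contra! hcon
  have hsub : (a : Set R) ⊆ ⋃ p ∈ associatedPrimes R M, (p : Set R) := by
    intro x hx
    rw [biUnion_associatedPrimes_eq_zero_divisors]
    have := hcon x hx
    rw [injective_iff_map_eq_zero] at this
    push Not at this
    obtain ⟨m, hm, hm0⟩ := this
    exact ⟨m, hm0, hm⟩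
  obtain ⟨p, hp, hap⟩ := (Ideal.subset_union_prime_finite (associatedPrimes.finite R M)
      (f := id) 0 0
    (fun p hp _ _ => hp.isPrime)).1 hsub
  obtain ⟨hp', m, hm⟩ := isAssociatedPrime_iff.1 hp
  have hmG : m ∈ Gam a M := ⟨1, fun r hr => by
    rw [pow_one] at hr
    have := hap hr
    rw [id, hm] at this
    simpa [Submodule.mem_colon_singleton] using this⟩
  rw [h, Submodule.mem_bot] at hmG
  refine hp'.ne_top (eq_top_iff.2 fun r _ => ?_)
  rw [hm, hmG]
  simp [Submodule.mem_colon_singleton]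

lemma LC.exists_pow_smul_eq_zero_of_finite [IsNoetherianRing R] (a : Ideal R) (i : ℕ)
    [Module.Finite R (LC a i (.of R M))] {x : R} (hx : x ∈ a) :
    ∃ t, ∀ z : LC a i (.of R M), x ^ t • z = 0 := by
  obtain ⟨t, ht⟩ := exists_pow_forall_of_fg (a := a) (⊤ : Submodule R (LC a i
      (.of R M))) Module.Finite.fg_top
    fun z _ => LC.exists_pow_smul_eq_zero a i z
  exact ⟨t, fun z => ht _ (Ideal.pow_mem_pow hx t) z Submodule.mem_top⟩

lemma fgAway_LC_succ_of_Gam_eq_bot [IsNoetherianRing R]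
    (hX : ∀ p q : PrimeSpectrum R, q ≤ p → p ∈ X → q ∈ X)
    {a : Ideal R} {i : ℕ}
    (ih : ∀ (M : Type) [AddCommGroup M] [Module R M] [Module.Finite R M],
      (∀ j ≤ i, LocFin X a j M) → FGAway X (LC a i (.of R M)))
    [Module.Finite R M] (hM : ∀ j ≤ i + 1, LocFin X a j M) (h : Gam a M = ⊥) :
    FGAway X (LC a (i + 1) (.of R M)) := by
  obtain ⟨x, hxa, hx⟩ := exists_mem_injective_mulMap h
  let g := (LinearMap.range (mulMap M x)).mkQ
  have hg : Function.Surjective g := Submodule.mkQ_surjective _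
  have hex : Function.Exact (mulMap M x) g := LinearMap.exact_map_mkQ_range _
  have hi := ih (M ⧸ LinearMap.range (mulMap M x)) fun j hj =>
    (hM j (by omega)).of_exact hx hg hex (hM (j + 1) (by omega))
  obtain ⟨δ, -, hδ⟩ := LC.exists_connecting a hx hg hex i
  have hmul (z : LC a (i + 1) (.of R M)) : LC.map a (i + 1) (mulMap M x) z = x • z :=
    LC.map_smul_id a (i + 1) x z
  refine FGAway.of_ker hX (x := x) (fun z => ?_) ?_ fun p hp => ?_
  · obtain ⟨t, ht⟩ := LC.exists_pow_smul_eq_zero a (i + 1) z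
    exact ⟨t, ht _ (Ideal.pow_mem_pow hxa t)⟩
  · refine hi.of_surjective
      (δ.codRestrict (LinearMap.ker (mulMap (LC a (i + 1) (.of R M)) x)) fun w => ?_) fun z => ?_
    · exact (hmul _).symm.trans (hδ.apply_apply_eq_zero w)
    · obtain ⟨w, hw⟩ := (hδ z).1 ((hmul _).trans z.2)
      exact ⟨w, Subtype.ext hw⟩
  · have := IsLocalization.isNoetherianRing p.asIdeal.primeCompl
      (Localization p.asIdeal.primeCompl) ‹_›
    have := hM (i + 1) le_rfl p hp
    obtain ⟨t, ht⟩ := LC.exists_pow_smul_eq_zero_of_finite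
      (a.map (algebraMap R (Localization p.asIdeal.primeCompl))) (i + 1)
      (M := LocalizedModule p.asIdeal.primeCompl M) (Ideal.mem_map_of_mem _ hxa)
    refine ⟨t, LC.exists_smul_smul_eq_zero p.asIdeal.primeCompl a (x ^ t) (i + 1) M fun z => ?_⟩
    rw [map_pow]
    exact ht z

lemma fgAway_LC [IsNoetherianRing R] (hX : ∀ p q : PrimeSpectrum R, q ≤ p → p ∈ X → q ∈ X)
    (a : Ideal R) (i : ℕ) :
    ∀ (M : Type) [AddCommGroup M] [Module R M] [Module.Finite R M],
      (∀ j ≤ i, LocFin X a j M) → FGAway X (LC a i (.of R M)) := by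
  induction i with
  | zero =>
    intro M _ _ _ _
    exact FGAway.of_finite.of_injective (LC.toMod a M) (LC.toMod_injective a)
  | succ i ih =>
    intro M _ _ _ hM
    have hT : Function.Exact (Gam a M).subtype (Gam a M).mkQ := LinearMap.exact_subtype_mkQ _
    have hT1 := (Gam a M).injective_subtype
    have hT2 := (Gam a M).mkQ_surjective
    have hsub := subsingleton_LC_of_Gam_eq_top a i _ (Gam_Gam (M := M) a)
    refine FGAway.of_injective (N := LC a (i + 1) (.of R (M ⧸ Gam a M))) ?_ (LC.map a (i + 1)
        (Gam a M).mkQ) ?_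
    swap
    · rw [injective_iff_map_eq_zero]
      intro z hz
      obtain ⟨w, rfl⟩ := (LC.map_exact a hT1 hT2 hT (i + 1) z).1 hz
      rw [Subsingleton.elim w 0, map_zero]
    have hM' : ∀ j ≤ i + 1, LocFin X a j (M ⧸ Gam a M) := fun j hj =>
      (hM j hj).of_exact hT1 hT2 hT (LocFin.of_Gam_eq_top (Gam_Gam a) j)
    exact fgAway_LC_succ_of_Gam_eq_bot hX ih hM' (Gam_quotient_Gam a)
end

lemma LC.subsingleton_of_subsingleton (a : Ideal R) (i : ℕ) {M : Type} [AddCommGroup M]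
    [Module R M] [Subsingleton M] :
    Subsingleton (LC a i (.of R M)) :=
  subsingleton_of_forall_eq 0 fun z => by
    rw [← LC.map_id a i z, Subsingleton.elim (LinearMap.id : M →ₗ[R] M) ((0 : R) • LinearMap.id),
      LC.map_smul_id, zero_smul]

lemma LC.subsingleton_of_eq_top {a : Ideal R} (h : a = ⊤) (i : ℕ) {M : Type} [AddCommGroup M]
    [Module R M] :
    Subsingleton (LC a i (.of R M)) :=
  subsingleton_of_forall_eq 0 fun z => by
    obtain ⟨t, ht⟩ := LC.exists_pow_smul_eq_zero a i z
    rw [← one_smul R z]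
    exact ht 1 (by rw [h, Ideal.top_pow]; trivial)

lemma finite_LC_of_notMem_support (a : Ideal R) (i : ℕ) (M : Type) [AddCommGroup M] [Module R M]
    [Module.Finite R M]
    {p : PrimeSpectrum R} (hp : p ∉ Module.support R (M ⧸ (a • ⊤ : Submodule R M))) :
    Module.Finite (Localization p.asIdeal.primeCompl)
      (LC (a.map (algebraMap R (Localization p.asIdeal.primeCompl))) i
        (.of _ (LocalizedModule p.asIdeal.primeCompl M))) := by
  rw [Module.support_quotient, Set.mem_inter_iff, not_and_or] at hp
  rcases hp with hp | hp
  · rw [Module.notMem_support_iff] at hp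
    have : Subsingleton (LocalizedModule p.asIdeal.primeCompl M) := hp
    have := LC.subsingleton_of_subsingleton (a.map (algebraMap R
        (Localization p.asIdeal.primeCompl))) i
      (M := LocalizedModule p.asIdeal.primeCompl M)
    infer_instance
  · rw [PrimeSpectrum.mem_zeroLocus, Set.not_subset] at hp
    obtain ⟨r, hr, hrp⟩ := hp
    have := LC.subsingleton_of_eq_top (a := a.map (algebraMap R
        (Localization p.asIdeal.primeCompl)))
      (Ideal.eq_top_of_isUnit_mem _ (Ideal.mem_map_of_mem _ hr)
        (IsLocalization.map_units (Localization p.asIdeal.primeCompl)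
            (⟨r, hrp⟩ : p.asIdeal.primeCompl))) i
      (M := LocalizedModule p.asIdeal.primeCompl M)
    infer_instance

lemma finite_LC_of_lt_finDim {a : Ideal R} {M : Type} [AddCommGroup M] [Module R M] {i : ℕ}
    (h : (i : ℕ∞) < finDim R a M) : Module.Finite R (LC a i (.of R M)) := by
  by_contra hcon
  obtain ⟨e⟩ := nonempty_locCoh_equiv a i M
  have hi : ¬ Module.Finite R ↥(locCoh R a i M) := fun hf => by
    have : Module.Finite R ((localCohomology a i).obj (ModuleCat.of R M)) := hf
    exact hcon (Module.Finite.equiv e.symm)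
  exact h.not_ge (sInf_le ⟨i, hi, rfl⟩)

end LocalCohomology

/-- For all `i < f_a^n(M)`, the local cohomology module `H^i_a(M)` is in dimension `< n`. -/
theorem inDimLT_of_lt_finDimN (R : Type) [CommRing R] [IsNoetherianRing R] (a : Ideal R)
    (M : Type) [AddCommGroup M] [Module R M] [Module.Finite R M] (n : ℕ)
    (i : ℕ) (hi : (i : ℕ∞) < finDimN R a n M) :
    InDimLT R ↥(locCoh R a i M) n := by
  obtain ⟨e⟩ := nonempty_locCoh_equiv a i M
  refine FGAway.inDimLT (FGAway.of_surjective (fgAway_LC ?_ a i M ?_) e.toLinearMap e.surjective)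
  · intro p q hqp hp
    exact le_trans hp (ringKrullDim_le_of_surjective (Ideal.Quotient.factor hqp)
        (Ideal.Quotient.factor_surjective hqp))
  · intro j hj p hp
    by_cases hs : p ∈ Module.support R (M ⧸ (a • ⊤ : Submodule R M))
    · exact finite_LC_of_lt_finDim ((Nat.cast_le.2 hj).trans_lt (hi.trans_le
        (sInf_le ⟨p, hs, hp, rfl⟩)))
    · exact finite_LC_of_notMem_support a j M hs
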